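/- Let n ≥ 3 be an integer, let ε ∈ (0,2), and let β ∈ ℝ with −n − ε < β < −n. Then there exists a constant C > 0 such that for every y ∈ ℝⁿ, ∫_{ℝⁿ} ‖x − y‖^{2−n−ε} ‖x‖^{ε} (1 + ‖x‖²)^{β/2} dx ≤ C (1 + ‖y‖²)^{(β+2)/2}. -/

import Mathlib

open MeasureTheory

lemma norm_sub_rpow_neg_le {E : Type*} [NormedAddCommGroup E] {e x : E}
    (he : ‖e‖ ≤ 1) (hx : 1 / 2 ≤ ‖x - e‖) {a : ℝ} (ha : 0 ≤ a) :
    ‖x - e‖ ^ (-a) ≤ (1 / 13 : ℝ) ^ (-a / 2) * (1 + ‖x‖ ^ 2) ^ (-a / 2) := by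
  have h : ‖x‖ ≤ ‖x - e‖ + ‖e‖ := by simpa using norm_add_le (x - e) e
  rw [← Real.mul_rpow (by norm_num) (by positivity),
    show ‖x - e‖ ^ (-a) = (‖x - e‖ ^ 2) ^ (-a / 2) by
      rw [← Real.rpow_natCast, ← Real.rpow_mul (norm_nonneg _)]; congr 1; push_cast; ring]
  exact Real.rpow_le_rpow_of_nonpos (by positivity) (by nlinarith [norm_nonneg x]) (by linarith)

section KernelEstimate

variable {E : Type*} [NormedAddCommGroup E] [NormedSpace ℝ E] [FiniteDimensional ℝ E]
  [MeasurableSpace E] [BorelSpace E] {μ : Measure E} [μ.IsAddHaarMeasure]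

lemma integrableOn_ball_norm_rpow (hd : 1 ≤ Module.finrank ℝ E) {s : ℝ}
    (hs : -(Module.finrank ℝ E : ℝ) < s) (r : ℝ) :
    IntegrableOn (fun x : E ↦ ‖x‖ ^ s) (Metric.ball 0 r) μ := by
  refine integrableOn_ball_of_norm_le_rpow (C := 1) (α := -s) hd (by linarith)
    (.of_forall fun x ↦ ?_) (Measurable.aestronglyMeasurable (by fun_prop))
  rw [neg_neg, one_mul, Real.norm_of_nonneg (by positivity)]

/-- Integrability of a power of the norm against a power of the Japanese bracket. -/
lemma integrable_rpow_one_add_norm_sq_mul_norm_rpow (hd : 1 ≤ Module.finrank ℝ E) {a s : ℝ}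
    (hs : s ≤ 0) (hs' : -(Module.finrank ℝ E : ℝ) < s)
    (has : s - a < -(Module.finrank ℝ E : ℝ)) :
    Integrable (fun x : E ↦ (1 + ‖x‖ ^ 2) ^ (-a / 2) * ‖x‖ ^ s) μ := by
  have hball := (integrable_indicator_iff Metric.isOpen_ball.measurableSet).2
    (integrableOn_ball_norm_rpow (μ := μ) hd hs' 1)
  have htail : Integrable (fun x : E ↦ (1 + ‖x‖ ^ 2) ^ (-(a - s) / 2)) μ :=
    integrable_rpow_neg_one_add_norm_sq (by linarith)
  refine (hball.add (htail.const_mul ((1 / 2 : ℝ) ^ (s / 2)))).mono' ?_ (.of_forall fun x ↦ ?_)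
  · exact Measurable.aestronglyMeasurable (by fun_prop)
  rw [Real.norm_of_nonneg (by positivity), Pi.add_apply]
  by_cases hx : ‖x‖ < 1
  · rw [Set.indicator_of_mem (by simpa using hx)]
    have h1 : (1 + ‖x‖ ^ 2) ^ (-a / 2) ≤ 1 :=
      Real.rpow_le_one_of_one_le_of_nonpos (by nlinarith [norm_nonneg x]) (by linarith)
    have h2 : (1 + ‖x‖ ^ 2) ^ (-a / 2) * ‖x‖ ^ s ≤ 1 * ‖x‖ ^ s := by gcongr
    have h3 : 0 ≤ (1 / 2 : ℝ) ^ (s / 2) * (1 + ‖x‖ ^ 2) ^ (-(a - s) / 2) := by positivity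
    linarith
  · rw [Set.indicator_of_notMem (by simpa using hx), zero_add]
    push Not at hx
    have h1 : ‖x‖ ^ s ≤ (1 / 2 : ℝ) ^ (s / 2) * (1 + ‖x‖ ^ 2) ^ (s / 2) := by
      rw [← Real.mul_rpow (by norm_num) (by positivity),
        show ‖x‖ ^ s = (‖x‖ ^ 2) ^ (s / 2) by
          rw [← Real.rpow_natCast, ← Real.rpow_mul (norm_nonneg x)]; congr 1; push_cast; ring]
      exact Real.rpow_le_rpow_of_nonpos (by positivity) (by nlinarith) (by linarith)
    calc (1 + ‖x‖ ^ 2) ^ (-a / 2) * ‖x‖ ^ s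
        ≤ (1 + ‖x‖ ^ 2) ^ (-a / 2) * ((1 / 2 : ℝ) ^ (s / 2) * (1 + ‖x‖ ^ 2) ^ (s / 2)) := by
          gcongr
      _ = (1 / 2 : ℝ) ^ (s / 2) * (1 + ‖x‖ ^ 2) ^ (-(a - s) / 2) := by
          rw [show -(a - s) / 2 = -a / 2 + s / 2 by ring, Real.rpow_add (by positivity)]
          ring

/-- A Riesz potential of a weight dominated by a power of the norm is bounded uniformly on the
unit ball, away from the singularity of the weight. -/
lemma exists_lintegral_norm_sub_rpow_mul_le (hd : 1 ≤ Module.finrank ℝ E) {a s : ℝ}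
    (ha : 0 ≤ a) (ha' : a < Module.finrank ℝ E) (hs : s ≤ 0)
    (hs' : -(Module.finrank ℝ E : ℝ) < s) (has : s - a < -(Module.finrank ℝ E : ℝ)) (M : ℝ) :
    ∃ C : ℝ, 0 < C ∧ ∀ (e : E) (w : E → ℝ), ‖e‖ ≤ 1 → (∀ x, 0 ≤ w x) →
      (∀ x, w x ≤ ‖x‖ ^ s) → (∀ x, ‖x - e‖ < 1 / 2 → w x ≤ M) →
      ∫⁻ x, ENNReal.ofReal (‖x - e‖ ^ (-a) * w x) ∂μ ≤ ENNReal.ofReal C := by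
  let f : E → ℝ := (Metric.ball 0 (1 / 2)).indicator fun x ↦ M * ‖x‖ ^ (-a)
  let g : E → ℝ := fun x ↦
    (1 / 13 : ℝ) ^ (-a / 2) * ((1 + ‖x‖ ^ 2) ^ (-a / 2) * ‖x‖ ^ s)
  have hf : Integrable f μ := (integrable_indicator_iff Metric.isOpen_ball.measurableSet).2
    ((integrableOn_ball_norm_rpow hd (by linarith) _).const_mul M)
  have hg : Integrable g μ :=
    (integrable_rpow_one_add_norm_sq_mul_norm_rpow hd hs hs' has).const_mul _
  have hf' := hf.lintegral_lt_top
  have hg' := hg.lintegral_lt_top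
  refine ⟨((∫⁻ x, ENNReal.ofReal (f x) ∂μ) + ∫⁻ x, ENNReal.ofReal (g x) ∂μ).toReal + 1,
    by positivity, fun e w he hw hws hwM ↦ ?_⟩
  have hle (x : E) : ENNReal.ofReal (‖x - e‖ ^ (-a) * w x) ≤
      ENNReal.ofReal (f (x - e)) + ENNReal.ofReal (g x) := by
    by_cases hx : ‖x - e‖ < 1 / 2
    · refine le_add_right (ENNReal.ofReal_le_ofReal ?_)
      simp only [f]
      rw [Set.indicator_of_mem (by simpa using hx), mul_comm]
      have := hwM x hx
      gcongr
    · refine le_add_left (ENNReal.ofReal_le_ofReal ?_)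
      simp only [g]
      rw [← mul_assoc]
      exact mul_le_mul (norm_sub_rpow_neg_le he (not_lt.1 hx) ha) (hws x) (hw x) (by positivity)
  calc ∫⁻ x, ENNReal.ofReal (‖x - e‖ ^ (-a) * w x) ∂μ
      ≤ ∫⁻ x, (ENNReal.ofReal (f (x - e)) + ENNReal.ofReal (g x)) ∂μ := lintegral_mono hle
    _ = (∫⁻ x, ENNReal.ofReal (f x) ∂μ) + ∫⁻ x, ENNReal.ofReal (g x) ∂μ := by
      rw [lintegral_add_right _ (by fun_prop),
        lintegral_sub_right_eq_self (fun x ↦ ENNReal.ofReal (f x)) e]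
    _ ≤ _ := by
      refine ENNReal.le_ofReal_iff_toReal_le (ENNReal.add_lt_top.2 ⟨hf', hg'⟩).ne
        (by positivity) |>.2 (by linarith)

lemma lintegral_comp_smul_of_pos (f : E → ENNReal) {r : ℝ} (hr : 0 < r) :
    ∫⁻ x, f x ∂μ = ENNReal.ofReal (r ^ Module.finrank ℝ E) * ∫⁻ x, f (r • x) ∂μ := by
  have h := lintegral_map_equiv (μ := μ) f
    (Homeomorph.smulOfNeZero r hr.ne' : E ≃ₜ E).toMeasurableEquiv
  simp only [Homeomorph.toMeasurableEquiv_coe, Homeomorph.smulOfNeZero_apply] at h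
  rw [← h, Measure.map_addHaar_smul μ hr.ne', lintegral_smul_measure, smul_eq_mul, ← mul_assoc,
    ← ENNReal.ofReal_mul (by positivity), abs_of_pos (by positivity),
    mul_inv_cancel₀ (by positivity), ENNReal.ofReal_one, one_mul]

/-- Homogeneity of the Riesz potential of a power of the norm. -/
lemma lintegral_norm_sub_rpow_mul_norm_rpow {y : E} (hy : y ≠ 0) (a s : ℝ) :
    ∫⁻ x, ENNReal.ofReal (‖x - y‖ ^ a * ‖x‖ ^ s) ∂μ =
      ENNReal.ofReal (‖y‖ ^ (Module.finrank ℝ E + a + s)) *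
        ∫⁻ x, ENNReal.ofReal (‖x - ‖y‖⁻¹ • y‖ ^ a * ‖x‖ ^ s) ∂μ := by
  have hy' : 0 < ‖y‖ := norm_pos_iff.2 hy
  have h (x : E) : ENNReal.ofReal (‖‖y‖ • x - y‖ ^ a * ‖‖y‖ • x‖ ^ s) =
      ENNReal.ofReal (‖y‖ ^ (a + s)) *
        ENNReal.ofReal (‖x - ‖y‖⁻¹ • y‖ ^ a * ‖x‖ ^ s) := by
    have h1 : ‖y‖ • x - y = ‖y‖ • (x - ‖y‖⁻¹ • y) := by
      rw [smul_sub, smul_inv_smul₀ hy'.ne']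
    rw [h1, norm_smul, norm_smul, norm_norm, Real.mul_rpow hy'.le (norm_nonneg _),
      Real.mul_rpow hy'.le (norm_nonneg _), ← ENNReal.ofReal_mul (by positivity),
      Real.rpow_add hy']
    congr 1
    ring
  rw [lintegral_comp_smul_of_pos _ hy']
  simp_rw [h]
  rw [lintegral_const_mul' _ _ ENNReal.ofReal_ne_top, ← mul_assoc,
    ← ENNReal.ofReal_mul (by positivity), ← Real.rpow_natCast, ← Real.rpow_add hy', ← add_assoc]

end KernelEstimate

/-- Kernel estimate for the Hölder-difference kernel: for `n ≥ 3`, `ε ∈ (0,2)` and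
`-n-ε < β < -n` there is `C > 0` with
`∫ ‖x-y‖^{2-n-ε} ‖x‖^ε (1+‖x‖²)^{β/2} dx ≤ C (1+‖y‖²)^{(β+2)/2}` for all `y ∈ ℝⁿ`. -/
theorem stmt13 (n : ℕ) (hn : 3 ≤ n) (ε : ℝ) (hε : ε ∈ Set.Ioo (0 : ℝ) 2)
    (β : ℝ) (hβ : -(n : ℝ) - ε < β) (hβ' : β < -(n : ℝ)) :
    ∃ C : ℝ, 0 < C ∧ ∀ y : EuclideanSpace ℝ (Fin n),
      (∫⁻ x : EuclideanSpace ℝ (Fin n),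
          ENNReal.ofReal (‖x - y‖ ^ (2 - (n : ℝ) - ε) * ‖x‖ ^ ε * (1 + ‖x‖ ^ 2) ^ (β / 2)))
        ≤ ENNReal.ofReal (C * (1 + ‖y‖ ^ 2) ^ ((β + 2) / 2)) := by
  obtain ⟨hε0, hε2⟩ := hε
  have hn' : (3 : ℝ) ≤ n := by exact_mod_cast hn
  have hfin : Module.finrank ℝ (EuclideanSpace ℝ (Fin n)) = n := finrank_euclideanSpace_fin
  obtain ⟨C, hC, hbound⟩ := exists_lintegral_norm_sub_rpow_mul_le
    (E := EuclideanSpace ℝ (Fin n)) (μ := volume) (a := n - 2 + ε) (s := ε + β)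
    (by rw [hfin]; lia) (by linarith) (by rw [hfin]; linarith) (by linarith)
    (by rw [hfin]; linarith) (by rw [hfin]; linarith) ((1 / 2 : ℝ) ^ (ε + β))
  rw [show -((n : ℝ) - 2 + ε) = 2 - n - ε by ring] at hbound
  have hsq (x : EuclideanSpace ℝ (Fin n)) (t : ℝ) : ‖x‖ ^ t = (‖x‖ ^ 2) ^ (t / 2) := by
    rw [← Real.rpow_natCast, ← Real.rpow_mul (norm_nonneg x)]
    congr 1
    push_cast
    ring
  have hweight (x : EuclideanSpace ℝ (Fin n)) :
      ‖x‖ ^ ε * (1 + ‖x‖ ^ 2) ^ (β / 2) ≤ ‖x‖ ^ (ε + β) := by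
    rcases eq_or_ne x 0 with rfl | hx
    · rw [norm_zero, Real.zero_rpow hε0.ne', zero_mul]
      positivity
    · have hx' : 0 < ‖x‖ := norm_pos_iff.2 hx
      rw [Real.rpow_add hx', hsq x β]
      gcongr ?_ * ?_
      exact Real.rpow_le_rpow_of_nonpos (by positivity) (by linarith) (by linarith)
  refine ⟨C * (1 / 2) ^ ((β + 2) / 2), by positivity, fun y ↦ ?_⟩
  rw [mul_assoc C, ← Real.mul_rpow (by norm_num) (by positivity)]
  simp_rw [mul_assoc]
  rcases le_total ‖y‖ 1 with hy | hy
  · refine (hbound y (fun x ↦ ‖x‖ ^ ε * (1 + ‖x‖ ^ 2) ^ (β / 2)) hy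
      (fun x ↦ by positivity) hweight fun x _ ↦ ?_).trans (ENNReal.ofReal_le_ofReal ?_)
    · calc ‖x‖ ^ ε * (1 + ‖x‖ ^ 2) ^ (β / 2)
          ≤ (1 + ‖x‖ ^ 2) ^ (ε / 2) * (1 + ‖x‖ ^ 2) ^ (β / 2) := by
            rw [hsq x ε]
            gcongr
            linarith
        _ = (1 + ‖x‖ ^ 2) ^ ((ε + β) / 2) := by
            rw [← Real.rpow_add (by positivity), add_div]
        _ ≤ 1 := Real.rpow_le_one_of_one_le_of_nonpos (by nlinarith [norm_nonneg x])
            (by linarith)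
        _ ≤ (1 / 2 : ℝ) ^ (ε + β) :=
            Real.one_le_rpow_of_pos_of_le_one_of_nonpos (by norm_num) (by norm_num) (by linarith)
    · exact le_mul_of_one_le_right hC.le <| Real.one_le_rpow_of_pos_of_le_one_of_nonpos
        (by positivity) (by nlinarith [norm_nonneg y]) (by linarith)
  · have hy0 : y ≠ 0 := norm_pos_iff.1 (by linarith)
    have he : ‖‖y‖⁻¹ • y‖ = 1 := norm_smul_inv_norm (𝕜 := ℝ) hy0
    calc ∫⁻ x : EuclideanSpace ℝ (Fin n), ENNReal.ofReal
            (‖x - y‖ ^ (2 - (n : ℝ) - ε) * (‖x‖ ^ ε * (1 + ‖x‖ ^ 2) ^ (β / 2)))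
        ≤ ∫⁻ x : EuclideanSpace ℝ (Fin n), ENNReal.ofReal
            (‖x - y‖ ^ (2 - (n : ℝ) - ε) * ‖x‖ ^ (ε + β)) :=
          lintegral_mono fun x ↦ ENNReal.ofReal_le_ofReal
            (mul_le_mul_of_nonneg_left (hweight x) (by positivity))
      _ ≤ ENNReal.ofReal (‖y‖ ^ (β + 2)) * ENNReal.ofReal C := by
          rw [lintegral_norm_sub_rpow_mul_norm_rpow hy0, hfin,
            show (n : ℝ) + (2 - n - ε) + (ε + β) = β + 2 by ring]
          gcongr
          refine hbound _ (fun x ↦ ‖x‖ ^ (ε + β)) he.le (fun x ↦ by positivity)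
            (fun x ↦ le_rfl) fun x hx ↦ ?_
          have h := norm_sub_norm_le (‖y‖⁻¹ • y) x
          rw [he, norm_sub_rev] at h
          exact Real.rpow_le_rpow_of_nonpos (by norm_num) (by linarith) (by linarith)
      _ ≤ _ := by
          rw [← ENNReal.ofReal_mul (by positivity), mul_comm, hsq]
          gcongr ENNReal.ofReal (C * ?_)
          exact Real.rpow_le_rpow_of_nonpos (by positivity) (by nlinarith) (by linarith)
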